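/- arXiv:2112.01946 — 2 statements merged into one kernel-verified Lean document; each statement's English description precedes it below -/
import Mathlib

section
/- Let n ≥ 5. Any family of 6 permutations of [5] totally shatters at most 8 of the 10 triples of [5]; consequently F_3(5,6) = 4/5, and by monotonicity F_3(n,6) ≤ 4/5 for all n ≥ 5. -/
/-- The strict order induced on a subset `X` of `[n]` by a permutation `P`
(thought of as assigning each element its position): `a` before `b` iff `P a < P b`. -/
def ordOn {n : ℕ} (P : Equiv.Perm (Fin n)) (X : Finset (Fin n)) :
    ↥X → ↥X → Prop :=
  fun a b => P a.val < P b.val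

/-- The set of orders (patterns) realized on `X` by a family `S` of permutations. -/
def realized {n : ℕ} (S : Set (Equiv.Perm (Fin n))) (X : Finset (Fin n)) :
    Set (↥X → ↥X → Prop) :=
  (fun P => ordOn P X) '' S

/-- A family `S` totally shatters a subset `X` if all `|X|!` relative orders of the
elements of `X` occur among the permutations of `S`. -/
def TotallyShatters {n : ℕ} (S : Set (Equiv.Perm (Fin n))) (X : Finset (Fin n)) : Prop :=
  (realized S X).ncard = Nat.factorial X.card

/-- `F k n m`: the maximum, over collections of `m` permutations of `[n]`, of the
fraction of `k`-subsets of `[n]` that are totally shattered. -/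
noncomputable def F (k n m : ℕ) : ℝ :=
  sSup {α : ℝ | ∃ S : Fin m → Equiv.Perm (Fin n),
    α = ({X : Finset (Fin n) | X.card = k ∧ TotallyShatters (Set.range S) X}.ncard : ℝ) /
      (n.choose k)}

/-- A family `f` of maps into an ordered type distinguishes a finset `X` if its members induce
pairwise different strict orders on `X`. -/
def Distinguishes {ι α β : Type*} [LT β] (f : ι → α → β) (X : Finset α) : Prop :=
  ∀ i j, (∀ a ∈ X, ∀ b ∈ X, (f i a < f i b ↔ f j a < f j b)) → i = j

instance {ι α β : Type*} [LT β] [Fintype ι] [DecidableEq ι] [DecidableLT β] (f : ι → α → β)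
    (X : Finset α) : Decidable (Distinguishes f X) := by
  unfold Distinguishes; infer_instance

theorem distinguishes_map {ι α α' β : Type*} [LT β] (f : ι → α → β) (e : α' ↪ α)
    (X : Finset α') : Distinguishes f (X.map e) ↔ Distinguishes (fun i a => f i (e a)) X := by
  simp [Distinguishes]

theorem ordOn_eq_iff {n : ℕ} (P Q : Equiv.Perm (Fin n)) (X : Finset (Fin n)) :
    ordOn P X = ordOn Q X ↔ ∀ a ∈ X, ∀ b ∈ X, (P a < P b ↔ Q a < Q b) := by
  simp [funext_iff, ordOn]

theorem totallyShatters_range_iff {n m : ℕ} (S : Fin m → Equiv.Perm (Fin n))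
    {X : Finset (Fin n)} (hX : X.card.factorial = m) :
    TotallyShatters (Set.range S) X ↔ Distinguishes (fun i a => S i a) X := by
  have himage : realized (Set.range S) X =
      (Finset.univ.image fun i => ordOn (S i) X : Finset _) := by
    simp [realized, ← Set.range_comp, Function.comp_def]
  have hinj := Finset.card_image_iff (s := (Finset.univ : Finset (Fin m)))
    (f := fun i => ordOn (S i) X)
  rw [Finset.card_univ, Fintype.card_fin] at hinj
  rw [TotallyShatters, himage, Set.ncard_coe_finset, hX, hinj]
  simp only [Finset.coe_univ, Set.injOn_univ, Function.Injective, ordOn_eq_iff, Distinguishes]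

/-- The three-element subsets of `Fin 5`, each listed increasingly. -/
def triples : List (Fin 5 × Fin 5 × Fin 5) :=
  [(0, 1, 2), (0, 1, 3), (0, 1, 4), (0, 2, 3), (0, 2, 4), (0, 3, 4),
    (1, 2, 3), (1, 2, 4), (1, 3, 4), (2, 3, 4)]

/-- The underlying set of a triple. -/
def tripleSet (t : Fin 5 × Fin 5 × Fin 5) : Finset (Fin 5) := {t.1, t.2.1, t.2.2}

theorem exists_tripleSet_eq : ∀ X ∈ Finset.powersetCard 3 (Finset.univ : Finset (Fin 5)),
    ∃ t ∈ triples, tripleSet t = X := by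
  decide +kernel

theorem tripleSet_injOn : ∀ t ∈ triples, ∀ u ∈ triples, tripleSet t = tripleSet u → t = u := by
  decide +kernel

theorem card_tripleSet : ∀ t ∈ triples, (tripleSet t).card = 3 := by
  decide +kernel

/-- A number encoding the relative order of the entries of `l` in the positions of a triple. -/
def pattern (l : List ℕ) (t : Fin 5 × Fin 5 × Fin 5) : ℕ :=
  let x := l.getD t.1 0
  let y := l.getD t.2.1 0
  let z := l.getD t.2.2 0
  cond (x.blt y) 4 0 + cond (x.blt z) 2 0 + cond (y.blt z) 1 0

theorem pattern_ofFn_eq {P Q : Equiv.Perm (Fin 5)} {t : Fin 5 × Fin 5 × Fin 5}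
    (h : pattern (List.ofFn fun i => (P i : ℕ)) t = pattern (List.ofFn fun i => (Q i : ℕ)) t) :
    ∀ a ∈ tripleSet t, ∀ b ∈ tripleSet t, (P a < P b ↔ Q a < Q b) := by
  obtain ⟨a, b, c⟩ := t
  have getD_eq (P : Equiv.Perm (Fin 5)) (i : Fin 5) :
      (List.ofFn fun i => (P i : ℕ)).getD i 0 = P i := by
    fin_cases i <;> rfl
  simp only [pattern, getD_eq] at h
  have bit (p q r p' q' r' : Bool)
      (h : cond p 4 0 + cond q 2 0 + cond r 1 0 = cond p' 4 0 + cond q' 2 0 + cond r' 1 0) :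
      p = p' ∧ q = q' ∧ r = r' := by
    revert p q r p' q' r'
    decide
  obtain ⟨hab, hac, hbc⟩ := bit _ _ _ _ _ _ h
  rw [Bool.eq_iff_iff, Nat.blt_eq, Nat.blt_eq, Fin.val_fin_lt, Fin.val_fin_lt] at hab hac hbc
  have swap {x y : Fin 5} (hxy : P x < P y ↔ Q x < Q y) : P y < P x ↔ Q y < Q x := by
    rcases eq_or_ne x y with rfl | hne
    · simp
    · have hP := P.injective.ne hne
      have hQ := Q.injective.ne hne
      rw [← not_iff_not, not_lt, not_lt, hP.le_iff_lt, hQ.le_iff_lt, hxy]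
  simp only [tripleSet, Finset.mem_insert, Finset.mem_singleton]
  rintro x (rfl | rfl | rfl) y (rfl | rfl | rfl)
  all_goals first | assumption | exact swap ‹_› | simp

/-- Whether `p` holds, for every entry `x` of the list, of the sublist of those later entries
that are related to `x` by `R`. -/
def forallRelated {α : Type*} (R : α → α → Bool) (p : List α → Bool) : List α → Bool
  | [] => true
  | x :: l => p (l.filter (R x)) && forallRelated R p l

/-- Exhaustive search: `true` certifies that no `d` entries of the list are pairwise
related by `R`. -/
def noClique {α : Type*} (R : α → α → Bool) : ℕ → List α → Bool
  | 0, _ => false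
  | d + 1, l => forallRelated R (noClique R d) l

theorem card_ne_of_noClique {α ι : Type*} [DecidableEq ι] {R : α → α → Bool} {d : ℕ}
    {l : List α} (h : noClique R d l = true) {c : ι → α} {I : Finset ι}
    (hinj : Set.InjOn c I) (hR : ∀ i ∈ I, ∀ j ∈ I, i ≠ j → R (c i) (c j) = true)
    (hl : ∀ i ∈ I, c i ∈ l) : I.card ≠ d := by
  induction d generalizing l I with
  | zero => simp [noClique] at h
  | succ d ihd =>
    rw [noClique] at h
    induction l with
    | nil =>
      have : I = ∅ := Finset.eq_empty_of_forall_notMem fun i hi => by simpa using hl i hi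
      simp [this]
    | cons x l ihl =>
      rw [forallRelated, Bool.and_eq_true] at h
      by_cases hx : ∃ i ∈ I, c i = x
      · obtain ⟨i, hi, rfl⟩ := hx
        have := ihd h.1 (I := I.erase i) (hinj.mono (by simp))
          (fun j hj k hk => hR j (Finset.mem_of_mem_erase hj) k (Finset.mem_of_mem_erase hk))
          (fun j hj => by
            obtain ⟨hji, hj⟩ := Finset.mem_erase.1 hj
            have hne : c j ≠ c i := fun hc => hji (hinj hj hi hc)
            exact List.mem_filter.2
              ⟨(List.mem_cons.1 (hl j hj)).resolve_left hne, hR i hi j hj hji.symm⟩)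
        rw [Finset.card_erase_of_mem hi] at this
        omega
      · push Not at hx
        exact ihl h.2 fun i hi => (List.mem_cons.1 (hl i hi)).resolve_left (hx i hi)

/-- Two lists disagree in every common position. -/
def disagree : List ℕ → List ℕ → Bool
  | x :: l, y :: l' => !(x.beq y) && disagree l l'
  | _, _ => true

theorem disagree_map {α : Type*} {f g : α → ℕ} {l : List α} (h : ∀ a ∈ l, f a ≠ g a) :
    disagree (l.map f) (l.map g) = true := by
  induction l with
  | nil => rfl
  | cons a l ih =>
    simp only [List.mem_cons, forall_eq_or_imp] at h
    have hbeq : Nat.beq (f a) (g a) = false := by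
      rw [← Bool.not_eq_true, Nat.beq_eq]
      exact h.1
    simp [disagree, ih h.2, hbeq]

theorem noClique_patterns : ∀ t ∈ triples, noClique disagree 5
    (((List.permutations' [0, 1, 2, 3, 4]).map fun l => (triples.erase t).map (pattern l)).filter
      (disagree ((triples.erase t).map (pattern [0, 1, 2, 3, 4])))) = true := by
  decide +kernel

theorem not_forall_distinguishes_of_eq_one {Q : Fin 6 → Equiv.Perm (Fin 5)} (hQ : Q 0 = 1)
    {t : Fin 5 × Fin 5 × Fin 5} (ht : t ∈ triples) :
    ¬ ∀ u ∈ triples.erase t, Distinguishes (fun i a => Q i a) (tripleSet u) := by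
  intro h
  set w : Fin 6 → List ℕ := fun i => List.ofFn fun a => (Q i a : ℕ) with hw
  have hne {i j : Fin 6} (hij : i ≠ j) : ∀ u ∈ triples.erase t, pattern (w i) u ≠ pattern (w j) u :=
    fun u hu heq => hij (h u hu i j (pattern_ofFn_eq heq))
  have hw0 : w 0 = [0, 1, 2, 3, 4] := by simp [hw, hQ, List.ofFn_succ]
  have hperm (i : Fin 6) : w i ∈ List.permutations' [0, 1, 2, 3, 4] := by
    rw [List.mem_permutations', ← hw0]
    have := Equiv.Perm.ofFn_comp_perm (Q i) (fun a : Fin 5 => (a : ℕ))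
    simpa [hw, hQ, Function.comp_def] using this
  refine card_ne_of_noClique (noClique_patterns t ht) (I := Finset.univ.erase (0 : Fin 6))
    (c := fun i => (triples.erase t).map (pattern (w i))) ?_ ?_ ?_ (by simp)
  · intro i _ j _ hij
    by_contra hne'
    obtain ⟨u, hu⟩ : ∃ u, u ∈ triples.erase t := by
      refine List.exists_mem_of_ne_nil _ (List.ne_nil_of_length_pos ?_)
      rw [List.length_erase_of_mem ht]
      decide
    exact hne hne' u hu (List.map_inj_left.1 hij u hu)
  · exact fun i _ j _ hij => disagree_map (hne hij)
  · intro i hi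
    refine List.mem_filter.2 ⟨List.mem_map.2 ⟨_, hperm i, rfl⟩, ?_⟩
    rw [← hw0]
    exact disagree_map (hne (Finset.ne_of_mem_erase hi).symm)

theorem card_distinguishes_le (S : Fin 6 → Equiv.Perm (Fin 5)) :
    ((Finset.powersetCard 3 Finset.univ).filter
      (Distinguishes fun i a => S i a)).card ≤ 8 := by
  by_contra! hlt
  have hsum := Finset.card_filter_add_card_filter_not
    (s := Finset.powersetCard 3 (Finset.univ : Finset (Fin 5))) (Distinguishes fun i a => S i a)
  rw [Finset.card_powersetCard, Finset.card_univ, Fintype.card_fin,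
    show Nat.choose 5 3 = 10 from rfl] at hsum
  have hbad := show ((Finset.powersetCard 3 Finset.univ).filter fun X =>
      ¬ Distinguishes (fun i a => S i a) X).card ≤ 1 by omega
  obtain ⟨T, hT, hone⟩ : ∃ T ∈ Finset.powersetCard 3 (Finset.univ : Finset (Fin 5)),
      ∀ X ∈ Finset.powersetCard 3 (Finset.univ : Finset (Fin 5)), X ≠ T →
        Distinguishes (fun i a => S i a) X := by
    by_cases hall : ∀ X ∈ Finset.powersetCard 3 (Finset.univ : Finset (Fin 5)),
        Distinguishes (fun i a => S i a) X
    · exact ⟨{0, 1, 2}, by decide, fun X hX _ => hall X hX⟩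
    · push Not at hall
      obtain ⟨T, hT, hTS⟩ := hall
      refine ⟨T, hT, fun X hX hXT => ?_⟩
      by_contra hXS
      exact hXT (Finset.card_le_one.1 hbad X (Finset.mem_filter.2 ⟨hX, hXS⟩) T
        (Finset.mem_filter.2 ⟨hT, hTS⟩))
  obtain ⟨t, ht, htT⟩ := exists_tripleSet_eq (T.map (S 0).toEmbedding) (by
    simpa [Finset.mem_powersetCard] using hT)
  refine not_forall_distinguishes_of_eq_one (Q := fun i => S i * (S 0)⁻¹) (by simp) ht
    fun u hu => ?_
  have hut : u ≠ t := ((List.Nodup.mem_erase_iff (by decide)).1 hu).1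
  have hu := List.mem_of_mem_erase hu
  have := hone ((tripleSet u).map (S 0).symm.toEmbedding)
    (by simp [Finset.mem_powersetCard, card_tripleSet u hu]) (by
      rintro rfl
      refine hut (tripleSet_injOn u hu t ht ?_)
      rw [htT, Finset.map_map]
      ext
      simp)
  rw [distinguishes_map] at this
  exact this

/-- Every injective map into a linear order is order-equivalent to a permutation. -/
theorem exists_perm_lt_iff_lt {n : ℕ} {β : Type*} [LinearOrder β] {f : Fin n → β}
    (hf : f.Injective) : ∃ Q : Equiv.Perm (Fin n), ∀ a b, Q a < Q b ↔ f a < f b := by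
  refine ⟨(Tuple.sort f)⁻¹, fun a b => ?_⟩
  have hmono : StrictMono (f ∘ Tuple.sort f) :=
    (Tuple.monotone_sort f).strictMono_of_injective (hf.comp (Tuple.sort f).injective)
  rw [← hmono.lt_iff_lt]
  simp

theorem card_distinguishes_powersetCard_le {n : ℕ} (S : Fin 6 → Equiv.Perm (Fin n))
    {Y : Finset (Fin n)} (hY : Y.card = 5) :
    ((Finset.powersetCard 3 Y).filter (Distinguishes fun i a => S i a)).card ≤ 8 := by
  let e := (Y.orderEmbOfFin hY).toEmbedding
  choose Q hQ using fun i =>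
    exists_perm_lt_iff_lt (f := fun a => S i (e a)) ((S i).injective.comp e.injective)
  have hmap : Finset.univ.map e = Y := Finset.map_orderEmbOfFin_univ Y hY
  refine le_trans (le_of_eq ?_) (card_distinguishes_le Q)
  rw [← hmap, Finset.powersetCard_map, Finset.filter_map, Finset.card_map]
  congr 1
  refine Finset.filter_congr fun X _ => ?_
  simp [Distinguishes, hQ]

theorem card_distinguishes_mul_five_le {n : ℕ} (hn : 5 ≤ n) (S : Fin 6 → Equiv.Perm (Fin n)) :
    ((Finset.powersetCard 3 Finset.univ).filter (Distinguishes fun i a => S i a)).card * 5 ≤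
      4 * n.choose 3 := by
  set D := (Finset.powersetCard 3 Finset.univ).filter (Distinguishes fun i a => S i a) with hD
  have hcount : D.card * (n - 3).choose 2 ≤ n.choose 5 * 8 := by
    have := Finset.card_mul_le_card_mul (s := D)
      (t := Finset.powersetCard 5 (Finset.univ : Finset (Fin n))) (· ⊆ ·)
      (m := (n - 3).choose 2) (n := 8) (fun X hX => ?_) (fun Y hY => ?_)
    · simpa using this
    · have hX3 : X.card = 3 := (Finset.mem_powersetCard.1 (Finset.mem_filter.1 hX).1).2
      have hcompl : (n - 3).choose 2 = (Finset.powersetCard 2 Xᶜ).card := by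
        simp [Finset.card_compl, hX3]
      rw [hcompl]
      refine Finset.card_le_card_of_injOn (X ∪ ·) (fun Z hZ => ?_) (fun Z hZ W hW hZW => ?_)
      · obtain ⟨hZX, hZ2⟩ := Finset.mem_powersetCard.1 hZ
        have hdisj : Disjoint X Z := disjoint_compl_right.mono_right hZX
        simp [Finset.bipartiteAbove, Finset.mem_powersetCard,
          Finset.card_union_of_disjoint hdisj, hX3, hZ2]
      · have hZX := (Finset.mem_powersetCard.1 hZ).1
        have hWX := (Finset.mem_powersetCard.1 hW).1
        have hdisjZ : Disjoint X Z := disjoint_compl_right.mono_right hZX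
        have hdisjW : Disjoint X W := disjoint_compl_right.mono_right hWX
        rw [← Finset.union_sdiff_cancel_left hdisjZ, ← Finset.union_sdiff_cancel_left hdisjW]
        exact congrArg (· \ X) hZW
    · refine le_trans (Finset.card_le_card fun X hX => ?_)
        (card_distinguishes_powersetCard_le S (Finset.mem_powersetCard.1 hY).2)
      obtain ⟨hXD, hXY⟩ := Finset.mem_filter.1 hX
      obtain ⟨hX3, hXS⟩ := Finset.mem_filter.1 hXD
      exact Finset.mem_filter.2
        ⟨Finset.mem_powersetCard.2 ⟨hXY, (Finset.mem_powersetCard.1 hX3).2⟩, hXS⟩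
  have hchoose : n.choose 5 * 10 = n.choose 3 * (n - 3).choose 2 :=
    Nat.choose_mul (k := 5) (s := 3) (by omega)
  have hpos : 0 < (n - 3).choose 2 := Nat.choose_pos (by omega)
  refine Nat.le_of_mul_le_mul_right ?_ hpos
  calc _ = D.card * (n - 3).choose 2 * 5 := by ring
    _ ≤ n.choose 5 * 8 * 5 := Nat.mul_le_mul_right 5 hcount
    _ = 4 * (n.choose 5 * 10) := by ring
    _ = _ := by rw [hchoose]; ring

theorem ncard_totallyShatters {n : ℕ} (S : Fin 6 → Equiv.Perm (Fin n)) :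
    {X : Finset (Fin n) | X.card = 3 ∧ TotallyShatters (Set.range S) X}.ncard =
      ((Finset.powersetCard 3 Finset.univ).filter (Distinguishes fun i a => S i a)).card := by
  rw [← Set.ncard_coe_finset]
  congr 1
  ext X
  simp only [Set.mem_ofPred_eq, Finset.coe_filter, Finset.mem_powersetCard_univ]
  exact and_congr_right fun hX => totallyShatters_range_iff S (by rw [hX]; rfl)

theorem fraction_le {n : ℕ} (hn : 5 ≤ n) (S : Fin 6 → Equiv.Perm (Fin n)) :
    ({X : Finset (Fin n) | X.card = 3 ∧ TotallyShatters (Set.range S) X}.ncard : ℝ) /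
      n.choose 3 ≤ 4 / 5 := by
  have hpos : (0 : ℝ) < n.choose 3 := by exact_mod_cast Nat.choose_pos (by omega)
  rw [ncard_totallyShatters, div_le_div_iff₀ hpos (by norm_num)]
  exact_mod_cast card_distinguishes_mul_five_le hn S

/-- Six permutations of `Fin 5`, each given with its inverse. -/
def extremalFamily : Fin 6 → Equiv.Perm (Fin 5) :=
  ![⟨![0, 1, 2, 3, 4], ![0, 1, 2, 3, 4], by decide, by decide⟩,
    ⟨![1, 0, 4, 3, 2], ![1, 0, 4, 3, 2], by decide, by decide⟩,
    ⟨![2, 3, 1, 0, 4], ![3, 2, 0, 1, 4], by decide, by decide⟩,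
    ⟨![2, 4, 0, 3, 1], ![2, 4, 0, 3, 1], by decide, by decide⟩,
    ⟨![3, 2, 4, 0, 1], ![3, 4, 1, 0, 2], by decide, by decide⟩,
    ⟨![4, 2, 1, 3, 0], ![4, 2, 1, 3, 0], by decide, by decide⟩]

theorem card_distinguishes_extremalFamily :
    ((Finset.powersetCard 3 Finset.univ).filter
      (Distinguishes fun i a => extremalFamily i a)).card = 8 := by
  decide +kernel

/-- any collection of `6` permutations of `[5]` totally shatters at most
`8` of the `10` triples; consequently `F_3(5,6) = 4/5` and `F_3(n,6) ≤ 4/5` for `n ≥ 5`. -/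
theorem stmt_12 :
    (∀ S : Fin 6 → Equiv.Perm (Fin 5),
      {X : Finset (Fin 5) | X.card = 3 ∧ TotallyShatters (Set.range S) X}.ncard ≤ 8) ∧
    F 3 5 6 = 4 / 5 ∧
    (∀ n : ℕ, 5 ≤ n → F 3 n 6 ≤ 4 / 5) := by
  refine ⟨fun S => ?_, ?_, fun n hn => ?_⟩
  · rw [ncard_totallyShatters]
    exact card_distinguishes_le S
  · refine IsGreatest.csSup_eq ⟨⟨extremalFamily, ?_⟩, ?_⟩
    · rw [ncard_totallyShatters, card_distinguishes_extremalFamily,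
        show Nat.choose 5 3 = 10 from rfl]
      norm_num
    · rintro _ ⟨S, rfl⟩
      exact fraction_le le_rfl S
  · refine csSup_le ⟨_, fun _ => 1, rfl⟩ ?_
    rintro _ ⟨S, rfl⟩
    exact fraction_le hn S
end

section
/- For all n ≥ 3, F_3(n,6) ≥ 2/5: there exists a family of 6 permutations of [n] that totally shatters at least (2/5)·C(n,3) triples. Moreover, when n = 4^r, there is such a family shattering at least n(n²-1)/15 triples. -/
/-- Six permutations of `{0, 1, 2, 3}`, given by positions, which together shatter every triple. -/
def perfectFamily : Fin 6 → Fin 4 → ℕ :=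
  ![![0, 1, 2, 3], ![0, 3, 2, 1], ![2, 0, 3, 1], ![2, 1, 0, 3], ![2, 3, 0, 1], ![3, 1, 2, 0]]

lemma perfectFamily_le (p : Fin 6) (d : Fin 4) : perfectFamily p d ≤ 3 := by
  decide +revert

lemma perfectFamily_zero (d : Fin 4) : perfectFamily 0 d = d := by
  decide +revert

lemma exists_perfectFamily_lt_lt {p q : Fin 6} (hpq : p ≠ q) {d : Fin 3 → Fin 4}
    (h01 : d 0 < d 1) (h12 : d 1 < d 2) :
    ∃ i j, perfectFamily p (d i) < perfectFamily p (d j) ∧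
      perfectFamily q (d j) < perfectFamily q (d i) := by
  have key : ∀ p q : Fin 6, p ≠ q → ∀ a b c : Fin 4, a < b → b < c →
      ∃ i j, perfectFamily p (![a, b, c] i) < perfectFamily p (![a, b, c] j) ∧
        perfectFamily q (![a, b, c] j) < perfectFamily q (![a, b, c] i) := by
    decide
  have hd : d = ![d 0, d 1, d 2] := by
    ext i
    fin_cases i <;> rfl
  rw [hd]
  exact key p q hpq _ _ _ h01 h12

/-- The position of `x` in the `p`-th order on base-4 strings of length `r`,
where the least significant digit of `x` selects the outermost block. -/
def digitKey (p : Fin 6) : ℕ → ℕ → ℕ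
  | 0, _ => 0
  | r + 1, x => perfectFamily p (Fin.ofNat 4 x) * 4 ^ r + digitKey p r (x / 4)

lemma digitKey_lt (p : Fin 6) (r x : ℕ) : digitKey p r x < 4 ^ r := by
  induction r generalizing x with
  | zero => simp [digitKey]
  | succ r ih =>
    have h := Nat.mul_le_mul_right (4 ^ r) (perfectFamily_le p (Fin.ofNat 4 x))
    have := ih (x / 4)
    rw [digitKey, pow_succ]
    omega

lemma digitKey_succ_lt_of_digit_lt {p : Fin 6} {r x y : ℕ}
    (h : perfectFamily p (Fin.ofNat 4 x) < perfectFamily p (Fin.ofNat 4 y)) :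
    digitKey p (r + 1) x < digitKey p (r + 1) y := by
  have h₁ := Nat.mul_le_mul_right (4 ^ r) (Nat.succ_le_of_lt h)
  have h₂ := digitKey_lt p r (x / 4)
  rw [Nat.succ_mul] at h₁
  rw [digitKey, digitKey]
  omega

lemma digitKey_succ_lt_of_digit_eq {p : Fin 6} {r x y : ℕ}
    (h : Fin.ofNat 4 x = Fin.ofNat 4 y) (hlt : digitKey p r (x / 4) < digitKey p r (y / 4)) :
    digitKey p (r + 1) x < digitKey p (r + 1) y := by
  rw [digitKey, digitKey, h]
  omega

/-- The triple `(x, y, z)` of base-4 strings of length `r` has increasing, pairwise distinct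
digits at the outermost level at which the three digits are not all equal. -/
def Splits : ℕ → ℕ → ℕ → ℕ → Prop
  | 0, _, _, _ => False
  | r + 1, x, y, z =>
    (Fin.ofNat 4 x < Fin.ofNat 4 y ∧ Fin.ofNat 4 y < Fin.ofNat 4 z) ∨
    (Fin.ofNat 4 x = Fin.ofNat 4 y ∧ Fin.ofNat 4 y = Fin.ofNat 4 z ∧
      Splits r (x / 4) (y / 4) (z / 4))

lemma Splits.digitKey_zero_lt {r x y z : ℕ} (h : Splits r x y z) :
    digitKey 0 r x < digitKey 0 r y ∧ digitKey 0 r y < digitKey 0 r z := by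
  induction r generalizing x y z with
  | zero => exact h.elim
  | succ r ih =>
    rcases h with ⟨hxy, hyz⟩ | ⟨hxy, hyz, h⟩
    · constructor <;> apply digitKey_succ_lt_of_digit_lt <;>
        simpa only [perfectFamily_zero, Fin.val_fin_lt]
    · exact ⟨digitKey_succ_lt_of_digit_eq hxy (ih h).1,
        digitKey_succ_lt_of_digit_eq hyz (ih h).2⟩

lemma Splits.exists_digitKey_lt_lt {r : ℕ} {t : Fin 3 → ℕ} (h : Splits r (t 0) (t 1) (t 2))
    {p q : Fin 6} (hpq : p ≠ q) :
    ∃ i j, digitKey p r (t i) < digitKey p r (t j) ∧ digitKey q r (t j) < digitKey q r (t i) := by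
  induction r generalizing t with
  | zero => exact h.elim
  | succ r ih =>
    rcases h with ⟨hxy, hyz⟩ | ⟨hxy, hyz, h⟩
    · obtain ⟨i, j, hp, hq⟩ :=
        exists_perfectFamily_lt_lt hpq (d := fun i => Fin.ofNat 4 (t i)) hxy hyz
      exact ⟨i, j, digitKey_succ_lt_of_digit_lt hp, digitKey_succ_lt_of_digit_lt hq⟩
    · obtain ⟨i, j, hp, hq⟩ := ih (t := fun i => t i / 4) h
      have heq : ∀ i, Fin.ofNat 4 (t i) = Fin.ofNat 4 (t 0) := by
        intro i
        fin_cases i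
        · rfl
        · exact hxy.symm
        · exact (hxy.trans hyz).symm
      exact ⟨i, j, digitKey_succ_lt_of_digit_eq ((heq i).trans (heq j).symm) hp,
        digitKey_succ_lt_of_digit_eq ((heq j).trans (heq i).symm) hq⟩

lemma sum_range_eq_sum_digit {M : Type*} [AddCommMonoid M] (n : ℕ) (f : ℕ → M) :
    ∑ x ∈ Finset.range n, f x =
      ∑ j : Fin 4, ∑ x ∈ Finset.range ((n + 3 - j) / 4), f (4 * x + j) := by
  have hmul (q : ℕ) : ∑ x ∈ Finset.range (4 * q), f x =
      ∑ j : Fin 4, ∑ x ∈ Finset.range q, f (4 * x + j) := by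
    induction q with
    | zero => simp
    | succ q ih =>
      simp only [Nat.mul_succ, Finset.sum_range_succ, ih, Finset.sum_add_distrib,
        Fin.sum_univ_four, Fin.val_zero, Fin.val_one, Fin.val_two, add_zero]
      simp only [← add_assoc]
      rfl
  obtain ⟨q, s, hs, rfl⟩ : ∃ q s, s < 4 ∧ n = 4 * q + s :=
    ⟨n / 4, n % 4, by omega, by omega⟩
  have h0 : (4 * q + 3) / 4 = q := by omega
  have h1 : (4 * q + 2) / 4 = q := by omega
  have h2 : (4 * q + 1) / 4 = q := by omega
  have h3 : 4 * q / 4 = q := by omega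
  have h4 : (4 * q + 4) / 4 = q + 1 := by omega
  have h5 : (4 * q + 5) / 4 = q + 1 := by omega
  have h6 : (4 * q + 6) / 4 = q + 1 := by omega
  have e2 : ((2 : Fin 4) : ℕ) = 2 := rfl
  have e3 : ((3 : Fin 4) : ℕ) = 3 := rfl
  interval_cases s <;>
    simp only [Finset.sum_range_succ, hmul, Fin.sum_univ_four, Fin.val_zero,
      Fin.val_one, e2, e3, add_zero, add_assoc, Nat.reduceAdd, Nat.add_sub_cancel,
      Nat.reduceSubDiff, h0, h1, h2, h3, h4, h5, h6] <;>
    abel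

open Classical in
/-- The number of triples of elements of `{0, …, n - 1}` satisfying `Splits r`. -/
noncomputable def splitCount (r n : ℕ) : ℕ :=
  ∑ x ∈ Finset.range n, ∑ y ∈ Finset.range n, ∑ z ∈ Finset.range n,
    if Splits r x y z then 1 else 0

lemma splitCount_zero (n : ℕ) : splitCount 0 n = 0 := by
  simp [splitCount, Splits]

lemma splits_succ_mul_add (r x y z : ℕ) (i j k : Fin 4) :
    Splits (r + 1) (4 * x + i) (4 * y + j) (4 * z + k) ↔
      (i < j ∧ j < k) ∨ (i = j ∧ j = k ∧ Splits r x y z) := by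
  have hmod (x : ℕ) (i : Fin 4) : Fin.ofNat 4 (4 * x + i) = i := by
    ext
    simp [Fin.ofNat, Nat.mod_eq_of_lt i.isLt]
  have hdiv (x : ℕ) (i : Fin 4) : (4 * x + i) / 4 = x := by omega
  simp only [Splits, hmod, hdiv]

lemma splitCount_succ (r n : ℕ) :
    splitCount (r + 1) n =
      splitCount r ((n + 3) / 4) + splitCount r ((n + 2) / 4) +
      splitCount r ((n + 1) / 4) + splitCount r (n / 4) +
      (((n + 3) / 4) * ((n + 2) / 4) * ((n + 1) / 4) + ((n + 3) / 4) * ((n + 2) / 4) * (n / 4) +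
        ((n + 3) / 4) * ((n + 1) / 4) * (n / 4) + ((n + 2) / 4) * ((n + 1) / 4) * (n / 4)) := by
  classical
  have hcomm : splitCount (r + 1) n = ∑ i : Fin 4, ∑ j : Fin 4, ∑ k : Fin 4,
      ∑ x ∈ Finset.range ((n + 3 - i) / 4), ∑ y ∈ Finset.range ((n + 3 - j) / 4),
        ∑ z ∈ Finset.range ((n + 3 - k) / 4),
          if (i < j ∧ j < k) ∨ (i = j ∧ j = k ∧ Splits r x y z) then 1 else 0 := by
    simp only [splitCount, sum_range_eq_sum_digit n, splits_succ_mul_add]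
    refine Finset.sum_congr rfl fun i _ => ?_
    rw [Finset.sum_comm]
    refine Finset.sum_congr rfl fun j _ => ?_
    refine Eq.trans ?_ Finset.sum_comm
    exact Finset.sum_congr rfl fun x _ => Finset.sum_comm
  rw [hcomm]
  simp [Fin.sum_univ_four, splitCount]
  ring

lemma le_splitCount (r n : ℕ) (hn : n ≤ 4 ^ r) :
    (n : ℤ) * (n - 1) * (n - 2) ≤ 15 * splitCount r n := by
  induction r generalizing n with
  | zero =>
    rw [pow_zero] at hn
    interval_cases n <;> simp
  | succ r ih =>
    obtain ⟨q, s, hs, rfl⟩ : ∃ q s, s < 4 ∧ n = 4 * q + s :=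
      ⟨n / 4, n % 4, by omega, by omega⟩
    rw [pow_succ] at hn
    have hq := ih q (by omega)
    have hq' : s ≠ 0 → ((q + 1 : ℕ) : ℤ) * ((q + 1 : ℕ) - 1) * ((q + 1 : ℕ) - 2) ≤
      15 * splitCount r (q + 1) := fun h => ih (q + 1) (by omega)
    have h0 : (4 * q + 3) / 4 = q := by omega
    have h1 : (4 * q + 2) / 4 = q := by omega
    have h2 : (4 * q + 1) / 4 = q := by omega
    have h3 : 4 * q / 4 = q := by omega
    have h4 : (4 * q + 4) / 4 = q + 1 := by omega
    have h5 : (4 * q + 5) / 4 = q + 1 := by omega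
    have h6 : (4 * q + 6) / 4 = q + 1 := by omega
    rw [splitCount_succ]
    interval_cases s <;>
      simp only [add_assoc, add_zero, Nat.reduceAdd, h0, h1, h2, h3, h4, h5, h6] <;>
      push_cast at hq hq' ⊢ <;>
      simp only [ne_eq, one_ne_zero, OfNat.ofNat_ne_zero, not_true_eq_false, not_false_eq_true,
        forall_const, false_implies] at hq' <;>
      nlinarith

lemma splitCount_four_pow (r : ℕ) :
    (15 * splitCount r (4 ^ r) : ℤ) = 4 ^ r * ((4 ^ r) ^ 2 - 1) := by
  induction r with
  | zero => simp [splitCount_zero]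
  | succ r ih =>
    have h0 : (4 * 4 ^ r + 3) / 4 = 4 ^ r := by omega
    have h1 : (4 * 4 ^ r + 2) / 4 = 4 ^ r := by omega
    have h2 : (4 * 4 ^ r + 1) / 4 = 4 ^ r := by omega
    have h3 : 4 * 4 ^ r / 4 = 4 ^ r := by omega
    rw [splitCount_succ, pow_succ', pow_succ', h0, h1, h2, h3]
    push_cast
    linear_combination 4 * ih

/-- A permutation of `Fin n` ordering the elements according to `digitKey p r`. -/
noncomputable def digitPerm (r n : ℕ) (p : Fin 6) : Equiv.Perm (Fin n) :=
  (Tuple.sort fun i : Fin n => digitKey p r i)⁻¹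

lemma digitPerm_lt {r n : ℕ} {p : Fin 6} {a b : Fin n} (h : digitKey p r a < digitKey p r b) :
    digitPerm r n p a < digitPerm r n p b := by
  by_contra! hle
  have := Tuple.monotone_sort (fun i : Fin n => digitKey p r i) hle
  simp [digitPerm] at this
  omega

lemma Splits.totallyShatters {r n : ℕ} {x y z : Fin n} (h : Splits r x y z) :
    ({x, y, z} : Finset (Fin n)).card = 3 ∧
      TotallyShatters (Set.range (digitPerm r n)) {x, y, z} := by
  obtain ⟨hxy, hyz⟩ := h.digitKey_zero_lt
  have hcard : ({x, y, z} : Finset (Fin n)).card = 3 := by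
    refine Finset.card_eq_three.2 ⟨x, y, z, ?_, ?_, ?_, rfl⟩ <;> rintro rfl <;> omega
  refine ⟨hcard, ?_⟩
  rw [TotallyShatters, hcard, realized, ← Set.range_comp, ← Nat.card_coe_set_eq,
    Nat.card_range_of_injective]
  · simp [Nat.factorial]
  · intro p q hpq
    by_contra hne
    obtain ⟨i, j, hp, hq⟩ := Splits.exists_digitKey_lt_lt (t := fun i => (![x, y, z] i : ℕ)) h hne
    have hmem (i : Fin 3) : ![x, y, z] i ∈ ({x, y, z} : Finset (Fin n)) := by
      fin_cases i <;> simp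
    have heq := congrFun (congrFun hpq ⟨_, hmem i⟩) ⟨_, hmem j⟩
    simp only [Function.comp, ordOn] at heq
    exact lt_asymm (heq.mp (digitPerm_lt hp)) (digitPerm_lt hq)

lemma splitCount_le_ncard (r n : ℕ) :
    splitCount r n ≤ {X : Finset (Fin n) |
      X.card = 3 ∧ TotallyShatters (Set.range (digitPerm r n)) X}.ncard := by
  classical
  have hcount : splitCount r n =
      {t : Fin n × Fin n × Fin n | Splits r t.1 t.2.1 t.2.2}.ncard := by
    rw [Set.ncard_eq_toFinset_card', Set.toFinset_ofPred, Finset.card_filter]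
    simp only [Fintype.sum_prod_type, splitCount, Finset.sum_range]
  rw [hcount]
  refine Set.ncard_le_ncard_of_injOn (fun t => {t.1, t.2.1, t.2.2})
    (fun t ht => Splits.totallyShatters ht) ?_ (Set.toFinite _)
  rintro ⟨x, y, z⟩ h ⟨x', y', z'⟩ h' heq
  obtain ⟨hxy, hyz⟩ := Splits.digitKey_zero_lt h
  obtain ⟨hxy', hyz'⟩ := Splits.digitKey_zero_lt h'
  simp only [Finset.ext_iff, Finset.mem_insert, Finset.mem_singleton] at heq hxy hyz hxy' hyz' ⊢
  have hx := (heq x).1 (by simp)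
  have hy := (heq y).1 (by simp)
  have hz := (heq z).1 (by simp)
  rcases hx with rfl | rfl | rfl <;> rcases hy with rfl | rfl | rfl <;>
    rcases hz with rfl | rfl | rfl <;> first | rfl | omega

/-- `F_3(n,6) ≥ 2/5` for all `n ≥ 3`, witnessed by a collection of `6`
permutations of `[n]` shattering at least `(2/5)·C(n,3)` triples; moreover when
`n = 4^r` there is such a collection shattering at least `n(n²-1)/15` triples. -/
theorem stmt_14 (n : ℕ) (hn : 3 ≤ n) :
    (2 / 5 : ℝ) ≤ F 3 n 6 ∧
    (∃ S : Fin 6 → Equiv.Perm (Fin n),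
      (2 / 5 : ℝ) * (n.choose 3) ≤
        ({X : Finset (Fin n) | X.card = 3 ∧ TotallyShatters (Set.range S) X}.ncard : ℝ)) ∧
    (∀ r : ℕ, 1 ≤ r → n = 4 ^ r →
      ∃ S : Fin 6 → Equiv.Perm (Fin n),
        ((n : ℝ) * ((n : ℝ) ^ 2 - 1)) / 15 ≤
          ({X : Finset (Fin n) | X.card = 3 ∧ TotallyShatters (Set.range S) X}.ncard : ℝ)) := by
  have hchoose : (n.choose 3 : ℝ) = n * (n - 1) * (n - 2) / 6 := by
    rw [Nat.cast_choose_eq_descPochhammer_div]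
    simp [descPochhammer_succ_eval, Nat.factorial]
  have hfam : ∃ S : Fin 6 → Equiv.Perm (Fin n),
      (2 / 5 : ℝ) * (n.choose 3) ≤
        ({X : Finset (Fin n) | X.card = 3 ∧ TotallyShatters (Set.range S) X}.ncard : ℝ) := by
    refine ⟨digitPerm n n, ?_⟩
    have h₁ : (n : ℝ) * (n - 1) * (n - 2) ≤ 15 * splitCount n n := by
      exact_mod_cast le_splitCount n n (Nat.lt_pow_self (by norm_num)).le
    have h₂ : (splitCount n n : ℝ) ≤ _ := Nat.cast_le.2 (splitCount_le_ncard n n)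
    linarith
  refine ⟨?_, hfam, ?_⟩
  · obtain ⟨S, hS⟩ := hfam
    have hpos : (0 : ℝ) < n.choose 3 := Nat.cast_pos.2 (Nat.choose_pos hn)
    refine le_trans ((le_div_iff₀ hpos).2 hS) (le_csSup (Set.Finite.bddAbove ?_) ⟨S, rfl⟩)
    exact (Set.finite_range fun S : Fin 6 → Equiv.Perm (Fin n) => _).subset
      fun α ⟨S, h⟩ => ⟨S, h.symm⟩
  · rintro r - rfl
    refine ⟨digitPerm r (4 ^ r), ?_⟩
    have h₁ : (15 * splitCount r (4 ^ r) : ℝ) = 4 ^ r * ((4 ^ r) ^ 2 - 1) := by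
      exact_mod_cast splitCount_four_pow r
    have h₂ : (splitCount r (4 ^ r) : ℝ) ≤ _ := Nat.cast_le.2 (splitCount_le_ncard r (4 ^ r))
    push_cast
    linarith
end
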